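/- arXiv:1507.01728 — 2 statements merged into one kernel-verified Lean document; each statement's English description precedes it below -/
import Mathlib

section
/- Let 1 ≤ k < n be integers with n ≥ 3k − 1, and let 0 ≤ c ≤ k−1. Then there exists Q such that for every prime power q ≥ Q: e_q(k,n,c) = e_q(k−c, n−c, 0), and every equidistant c-intersecting code C ⊆ G_q(k,n) with |C| = e_q(k,n,c) is a sunflower. -/
open Submodule Module Set

/-- The orthogonal complement of a subspace of `Fin n → F` with respect to the
standard bilinear form `(x, y) ↦ ∑ i, x i * y i`. -/
def stdOrth {F : Type} [Field F] {n : ℕ} (U : Submodule F (Fin n → F)) :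
    Submodule F (Fin n → F) where
  carrier := {x | ∀ y ∈ U, ∑ i, x i * y i = 0}
  add_mem' := by
    intro a b ha hb y hy
    simp only [Set.mem_setOf_eq] at *
    simp [add_mul, Finset.sum_add_distrib, ha y hy, hb y hy]
  zero_mem' := by intro y hy; simp
  smul_mem' := by
    intro c a ha y hy
    simp only [Set.mem_setOf_eq] at *
    simp [smul_eq_mul, mul_assoc, ← Finset.mul_sum, ha y hy]

/-- An equidistant `c`-intersecting subspace code of constant dimension `k` in `F^n`:
a set of at least two `k`-dimensional subspaces, any two distinct members of which
intersect in dimension `c`. -/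
def IsEquidistantCode (F : Type) [Field F] (n k c : ℕ)
    (C : Set (Submodule F (Fin n → F))) : Prop :=
  2 ≤ C.ncard ∧ (∀ U ∈ C, Module.finrank F U = k) ∧
    ∀ U ∈ C, ∀ V ∈ C, U ≠ V → Module.finrank F ↥(U ⊓ V) = c

/-- A set of subspaces is a sunflower if there is a common center `Z` equal to the
intersection of any two distinct members. -/
def IsSunflower {F : Type} [Field F] {n : ℕ} (C : Set (Submodule F (Fin n → F))) : Prop :=
  ∃ Z : Submodule F (Fin n → F), ∀ U ∈ C, ∀ V ∈ C, U ≠ V → U ⊓ V = Z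

/-- `eMax F n k c` is the maximum cardinality of an equidistant `c`-intersecting
code of constant dimension `k` in `F^n`. -/
noncomputable def eMax (F : Type) [Field F] (n k c : ℕ) : ℕ :=
  sSup {m | ∃ C : Set (Submodule F (Fin n → F)), IsEquidistantCode F n k c C ∧ C.ncard = m}

theorem deza_sets {P : Type*} [Fintype P] [DecidableEq P] (C : Finset (Finset P)) (K L : ℕ)
    (hL : L < K) (hK : ∀ A ∈ C, A.card = K)
    (hI : ∀ A ∈ C, ∀ B ∈ C, A ≠ B → (A ∩ B).card = L) (hb : 2 * K * K + 1 < C.card) :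
    ∃ H : Finset P, ∀ A ∈ C, ∀ B ∈ C, A ≠ B → A ∩ B = H := by
  classical
  set b := C.card with hbdef
  let deg : P → ℕ := fun x => (C.filter (fun A => x ∈ A)).card
  let codeg : P → ℕ := fun x => (C.filter (fun A => x ∉ A)).card
  have hde : ∀ x, deg x + codeg x = b := fun x =>
    Finset.card_filter_add_card_filter_not (s := C) (fun A => x ∈ A)
  -- quadratic form identity
  have hquad : ∀ a : Finset P → ℤ, ∑ A ∈ C, a A = 0 →
      ∑ p : P, (∑ A ∈ C, a A * (if p ∈ A then 1 else 0)) ^ 2 = ((K : ℤ) - L) * ∑ A ∈ C, a A ^ 2 := by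
    intro a ha
    have h1 : ∀ p : P, (∑ A ∈ C, a A * (if p ∈ A then (1:ℤ) else 0)) ^ 2
        = ∑ A ∈ C, ∑ B ∈ C, a A * a B * (if p ∈ A ∩ B then 1 else 0) := by
      intro p
      rw [sq, Finset.sum_mul_sum]
      refine Finset.sum_congr rfl fun A _ => Finset.sum_congr rfl fun B _ => ?_
      by_cases h : p ∈ A <;> by_cases h' : p ∈ B <;> simp [h, h']
    simp_rw [h1]
    rw [Finset.sum_comm]
    have h2 : ∀ A ∈ C, ∑ p : P, ∑ B ∈ C, a A * a B * (if p ∈ A ∩ B then (1:ℤ) else 0)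
        = ((K:ℤ) - L) * a A ^ 2 := by
      intro A hA
      rw [Finset.sum_comm]
      have h3 : ∀ B ∈ C, ∑ p : P, a A * a B * (if p ∈ A ∩ B then (1:ℤ) else 0)
          = L * a A * a B + (if A = B then ((K:ℤ) - L) * a A ^ 2 else 0) := by
        intro B hB
        rw [← Finset.mul_sum, Finset.sum_boole, Finset.filter_mem_eq_inter, Finset.univ_inter]
        split_ifs with h
        · subst h; rw [Finset.inter_self, hK A hA]; ring
        · rw [hI A hA B hB h]; ring
      rw [Finset.sum_congr rfl h3, Finset.sum_add_distrib, ← Finset.mul_sum, ha,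
        Finset.sum_ite_eq]
      simp [hA]
    rw [Finset.sum_congr rfl h2, ← Finset.mul_sum]
  have hprod : ∀ x, (deg x : ℤ) * codeg x ≤ (K - L) * (deg x + codeg x) := by
    intro x
    rcases Nat.eq_zero_or_pos (deg x) with h0 | hd
    · rw [h0]; push_cast; have : (0:ℤ) ≤ (K - L) := by omega
      have := mul_nonneg this (Int.natCast_nonneg (codeg x)); linarith
    rcases Nat.eq_zero_or_pos (codeg x) with h0 | he
    · rw [h0]; push_cast; have : (0:ℤ) ≤ (K - L) := by omega
      have := mul_nonneg this (Int.natCast_nonneg (deg x)); linarith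
    let a : Finset P → ℤ := fun A => if x ∈ A then (codeg x : ℤ) else -(deg x : ℤ)
    have ha : ∑ A ∈ C, a A = 0 := by
      simp only [a, Finset.sum_ite, Finset.sum_const]
      simp only [nsmul_eq_mul]
      change (deg x : ℤ) * codeg x + (codeg x : ℤ) * -(deg x : ℤ) = 0
      ring
    have ha2 : ∑ A ∈ C, a A ^ 2 = deg x * codeg x ^ 2 + codeg x * deg x ^ 2 := by
      simp only [a, ite_pow, Finset.sum_ite, Finset.sum_const]
      simp only [nsmul_eq_mul]
      change (deg x : ℤ) * codeg x ^ 2 + (codeg x : ℤ) * (-(deg x : ℤ)) ^ 2 = _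
      ring
    have hx : ∑ A ∈ C, a A * (if x ∈ A then (1:ℤ) else 0) = deg x * codeg x := by
      have : ∀ A ∈ C, a A * (if x ∈ A then (1:ℤ) else 0) = if x ∈ A then (codeg x : ℤ) else 0 := by
        intro A _; by_cases h : x ∈ A <;> simp [a, h]
      rw [Finset.sum_congr rfl this, ← Finset.sum_filter, Finset.sum_const, nsmul_eq_mul]
    have hq := hquad a ha
    have hle := Finset.single_le_sum
      (f := fun p => (∑ A ∈ C, a A * (if p ∈ A then (1:ℤ) else 0)) ^ 2)
      (fun i _ => sq_nonneg _) (Finset.mem_univ x)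
    simp only [hx, hq, ha2] at hle
    have hpos : (0:ℤ) < deg x * codeg x := by positivity
    have : (deg x * codeg x : ℤ) * (deg x * codeg x) ≤
      (deg x * codeg x) * ((K - L) * (deg x + codeg x)) := by linarith
    exact le_of_mul_le_mul_left this hpos
  have hmin : ∀ x, deg x ≤ 2 * K ∨ codeg x ≤ 2 * K := by
    intro x
    by_contra! h
    have h1 := hprod x
    obtain ⟨h2, h3⟩ := h
    zify at h2 h3
    have hL0 : (0:ℤ) ≤ L := by positivity
    nlinarith [mul_nonneg hL0 (Int.natCast_nonneg (deg x)),
      mul_nonneg hL0 (Int.natCast_nonneg (codeg x))]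
  let H : Finset P := Finset.univ.filter (fun x => codeg x ≤ 2 * K)
  have hdeg : ∀ A ∈ C, ∑ x ∈ A, deg x + L = K + L * b := by
    intro A hA
    have h1 : ∑ x ∈ A, deg x = ∑ B ∈ C, (A ∩ B).card := by
      simp only [deg, Finset.card_filter]
      rw [Finset.sum_comm]
      refine Finset.sum_congr rfl fun B _ => ?_
      rw [← Finset.card_filter, Finset.filter_mem_eq_inter]
    rw [h1, ← Finset.add_sum_erase _ _ hA, Finset.inter_self, hK A hA,
      Finset.sum_congr rfl (fun B hB => hI A hA B (Finset.mem_of_mem_erase hB)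
        (Finset.ne_of_mem_erase hB).symm), Finset.sum_const, Finset.card_erase_of_mem hA]
    have : 1 ≤ b := Finset.card_pos.2 ⟨A, hA⟩
    obtain ⟨b', hb'⟩ := Nat.exists_eq_add_of_le this
    rw [← hbdef, hb']; simp; ring
  have hge : ∀ A ∈ C, L ≤ (A ∩ H).card := by
    intro A hA
    by_contra! h
    have h1 := hdeg A hA
    have h2 : ∑ x ∈ A, deg x ≤ ∑ x ∈ A, ((if x ∈ H then b else 0) + 2 * K) := by
      refine Finset.sum_le_sum fun x _ => ?_
      by_cases hx : x ∈ H
      · have := hde x; simp [hx]; omega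
      · have h3 : ¬ codeg x ≤ 2 * K := by simpa [H] using hx
        have := hmin x; simp [hx]; omega
    rw [Finset.sum_add_distrib, ← Finset.sum_filter, Finset.sum_const, Finset.sum_const,
      Finset.filter_mem_eq_inter, hK A hA] at h2
    simp only [smul_eq_mul] at h2
    obtain ⟨t, ht⟩ := Nat.exists_eq_add_of_lt h
    have : L * b = (A ∩ H).card * b + t * b + b := by rw [ht]; ring
    nlinarith [Nat.zero_le (t * b)]
  have hHle : H.card ≤ L := by
    by_contra! h
    obtain ⟨T, hTH, hT⟩ := Finset.exists_subset_card_eq (Nat.succ_le_of_lt h)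
    have h1 : (T.biUnion (fun x => C.filter (fun A => x ∉ A))).card ≤ T.card * (2 * K) := by
      refine Finset.card_biUnion_le_card_mul _ _ _ fun x hx => ?_
      have := hTH hx
      simpa [H] using this
    have h2 : T.card * (2 * K) ≤ K * (2 * K) := Nat.mul_le_mul_right _ (by omega)
    have h3 : 1 < (C \ (T.biUnion (fun x => C.filter (fun A => x ∉ A)))).card := by
      have := Finset.le_card_sdiff (T.biUnion (fun x => C.filter (fun A => x ∉ A))) C
      have e : 2 * K * K = K * (2 * K) := by ring
      omega
    obtain ⟨A, hA, B, hB, hAB⟩ := Finset.one_lt_card.1 h3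
    have key : ∀ A ∈ C \ (T.biUnion (fun x => C.filter (fun A => x ∉ A))), A ∈ C ∧ T ⊆ A := by
      intro A hA
      simp only [Finset.mem_sdiff, Finset.mem_biUnion, Finset.mem_filter, not_exists, not_and,
        not_not] at hA
      exact ⟨hA.1, fun x hx => hA.2 x hx hA.1⟩
    obtain ⟨hA1, hA2⟩ := key A hA
    obtain ⟨hB1, hB2⟩ := key B hB
    have := Finset.card_le_card (Finset.subset_inter hA2 hB2)
    rw [hI A hA1 B hB1 hAB] at this
    omega
  have hsub : ∀ A ∈ C, H ⊆ A := by
    intro A hA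
    have : A ∩ H = H := Finset.eq_of_subset_of_card_le Finset.inter_subset_right
      (hHle.trans (hge A hA))
    exact Finset.inter_eq_right.1 this
  refine ⟨H, fun A hA B hB hAB => (Finset.eq_of_subset_of_card_le
    (Finset.subset_inter (hsub A hA) (hsub B hB)) ?_).symm⟩
  rw [hI A hA B hB hAB]
  exact (hge A hA).trans (Finset.card_le_card Finset.inter_subset_right)

section helpers
open scoped LinearAlgebra.Projectivization

theorem finrank_comap_surj {F V W : Type*} [Field F] [AddCommGroup V] [Module F V]
    [FiniteDimensional F V] [AddCommGroup W] [Module F W] (f : V →ₗ[F] W)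
    (hf : Function.Surjective f) (U : Submodule F W) :
    Module.finrank F (U.comap f) = Module.finrank F U + Module.finrank F (LinearMap.ker f) := by
  have h := LinearMap.finrank_range_add_finrank_ker (f.domRestrict (U.comap f))
  rw [LinearMap.range_domRestrict, Submodule.map_comap_eq_of_surjective hf] at h
  rw [← h, LinearMap.ker_domRestrict]
  congr 1
  exact LinearEquiv.finrank_eq (Submodule.comapSubtypeEquivOfLe (fun x hx => by
    simp only [Submodule.mem_comap, LinearMap.mem_ker.1 hx, U.zero_mem]))

theorem code_comap {F : Type} [Field F] [Finite F] {n m k c : ℕ}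
    (f : (Fin n → F) →ₗ[F] (Fin m → F)) (hf : Function.Surjective f)
    (hker : Module.finrank F (LinearMap.ker f) = c)
    (C : Set (Submodule F (Fin m → F))) (hC : IsEquidistantCode F m k 0 C) :
    IsEquidistantCode F n (k + c) c ((fun U => U.comap f) '' C) ∧
      ((fun U : Submodule F (Fin m → F) => U.comap f) '' C).ncard = C.ncard := by
  have hinj : Function.Injective (fun U : Submodule F (Fin m → F) => U.comap f) :=
    Submodule.comap_injective_of_surjective hf
  have hcard := Set.ncard_image_of_injective C hinj
  refine ⟨⟨by rw [hcard]; exact hC.1, ?_, ?_⟩, hcard⟩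
  · rintro _ ⟨U, hU, rfl⟩
    rw [finrank_comap_surj f hf, hC.2.1 U hU, hker]
  · rintro _ ⟨U, hU, rfl⟩ _ ⟨V, hV, rfl⟩ hne
    have hUV : U ≠ V := fun h => hne (by rw [h])
    change Module.finrank F ↥((U ⊓ V).comap f) = c
    rw [finrank_comap_surj f hf, hC.2.2 U hU V hV hUV, hker, zero_add]

theorem code_le_eMax {F : Type} [Field F] [Finite F] {n k c : ℕ}
    {C : Set (Submodule F (Fin n → F))} (hC : IsEquidistantCode F n k c C) :
    C.ncard ≤ eMax F n k c := by
  have : Finite (Submodule F (Fin n → F)) := inferInstance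
  refine le_csSup ⟨Nat.card (Submodule F (Fin n → F)), ?_⟩ ⟨C, hC, rfl⟩
  rintro _ ⟨D, _, rfl⟩
  exact Set.ncard_le_card D

theorem eMax_attained {F : Type} [Field F] [Finite F] {n k c : ℕ}
    {C : Set (Submodule F (Fin n → F))} (hC : IsEquidistantCode F n k c C) :
    ∃ D, IsEquidistantCode F n k c D ∧ D.ncard = eMax F n k c := by
  have : Finite (Submodule F (Fin n → F)) := inferInstance
  refine Nat.sSup_mem (s := {m | ∃ C : Set (Submodule F (Fin n → F)),
    IsEquidistantCode F n k c C ∧ C.ncard = m}) ⟨_, C, hC, rfl⟩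
    ⟨Nat.card (Submodule F (Fin n → F)), ?_⟩
  rintro _ ⟨D, _, rfl⟩
  exact Set.ncard_le_card D

/-- Spread-type codes from field multiplication. -/
theorem exists_spread (F : Type) [Field F] [Fintype F] (r s : ℕ) (hr : 1 ≤ r) (hrs : r ≤ s) :
    ∃ C : Set (Submodule F (Fin (r + s) → F)), IsEquidistantCode F (r + s) r 0 C ∧
      C.ncard = Fintype.card F ^ s := by
  obtain ⟨p, hp⟩ := CharP.exists F
  have : Fact p.Prime := ⟨CharP.char_is_prime F p⟩
  have : NeZero s := ⟨by omega⟩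
  let L := FiniteField.Extension F p s
  have hL : Module.finrank F L = s := FiniteField.finrank_extension F p s
  obtain ⟨i, hi⟩ : ∃ i : (Fin r → F) →ₗ[F] L, Function.Injective i :=
    finrank_le_iff_exists_linearMap.1 (by rw [hL]; simpa using hrs)
  let E : ((Fin r → F) × L) ≃ₗ[F] (Fin (r + s) → F) :=
    LinearEquiv.ofFinrankEq _ _ (by simp [hL])
  let g : L → (Fin r → F) →ₗ[F] (Fin (r + s) → F) := fun a =>
    E.toLinearMap ∘ₗ (LinearMap.prod LinearMap.id (LinearMap.mulLeft F a ∘ₗ i))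
  have hg : ∀ a b w w', g a w = g b w' → w = w' ∧ a * i w = b * i w' := by
    intro a b w w' h
    have := E.injective h
    simpa [Prod.ext_iff] using this
  have hfr : ∀ a, Module.finrank F (LinearMap.range (g a)) = r := by
    intro a
    rw [LinearMap.finrank_range_of_inj (fun w w' h => (hg _ _ _ _ h).1)]
    simp
  have hint : ∀ a b, a ≠ b → LinearMap.range (g a) ⊓ LinearMap.range (g b) = ⊥ := by
    intro a b hab
    rw [eq_bot_iff]
    rintro _ ⟨⟨w, rfl⟩, ⟨w', hw'⟩⟩
    obtain ⟨h1, h2⟩ := hg _ _ _ _ hw'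
    subst h1
    have h3 : i w' = 0 := by
      by_contra h0
      exact hab (mul_right_cancel₀ h0 h2).symm
    have : w' = 0 := hi (by rw [h3, map_zero])
    simp [this]
  have hinj : Function.Injective (fun a => LinearMap.range (g a)) := by
    intro a b h
    by_contra hab
    have h1 := hint a b hab
    have h2 := hfr a
    simp only at h
    rw [← h, inf_idem] at h1
    rw [h1, finrank_bot] at h2
    omega
  have hcard : (Set.range (fun a => LinearMap.range (g a))).ncard = Fintype.card F ^ s := by
    rw [← Set.image_univ, Set.ncard_image_of_injective _ hinj, Set.ncard_univ,
      FiniteField.natCard_extension, Nat.card_eq_fintype_card]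
  refine ⟨_, ⟨?_, ?_, ?_⟩, hcard⟩
  · rw [hcard]
    have h2 : 2 ≤ Fintype.card F := Fintype.one_lt_card
    calc 2 ≤ Fintype.card F := h2
      _ ≤ _ := Nat.le_self_pow (by omega) _
  · rintro _ ⟨a, rfl⟩; exact hfr a
  · rintro _ ⟨a, rfl⟩ _ ⟨b, rfl⟩ hab
    have hab' : a ≠ b := fun h => hab (by rw [h])
    simp only
    rw [hint a b hab', finrank_bot]

/-- Points of a subspace. -/
noncomputable def projPts {F V : Type} [Field F] [AddCommGroup V] [Module F V] [Finite V]
    (U : Submodule F V) : Finset (ℙ F V) :=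
  (Set.toFinite {p : ℙ F V | p.submodule ≤ U}).toFinset

theorem mem_projPts {F V : Type} [Field F] [AddCommGroup V] [Module F V] [Finite V]
    (U : Submodule F V) (p : ℙ F V) : p ∈ projPts U ↔ p.submodule ≤ U := by
  simp [projPts]

theorem projPts_inj {F V : Type} [Field F] [AddCommGroup V] [Module F V] [Finite V]
    {U W : Submodule F V} (h : projPts U = projPts W) : U = W := by
  have key : ∀ {U W : Submodule F V}, projPts U = projPts W → U ≤ W := by
    intro U W h x hx
    by_cases h0 : x = 0
    · simp [h0]
    have h1 : Projectivization.mk F x h0 ∈ projPts U := by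
      rw [mem_projPts, Projectivization.submodule_mk, Submodule.span_singleton_le_iff_mem]
      exact hx
    rw [h, mem_projPts, Projectivization.submodule_mk, Submodule.span_singleton_le_iff_mem] at h1
    exact h1
  exact le_antisymm (key h) (key h.symm)

theorem projPts_inf {F V : Type} [Field F] [AddCommGroup V] [Module F V] [Finite V]
    [DecidableEq (ℙ F V)] (U W : Submodule F V) : projPts (U ⊓ W) = projPts U ∩ projPts W := by
  ext p; simp [mem_projPts]

theorem card_projPts {F V : Type} [Field F] [Finite F] [AddCommGroup V] [Module F V] [Finite V]
    (U : Submodule F V) :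
    (projPts U).card = ∑ i ∈ Finset.range (Module.finrank F U), Nat.card F ^ i := by
  classical
  rw [← Projectivization.card_of_finrank F U rfl]
  have hinj : Function.Injective (Projectivization.map U.subtype U.injective_subtype) :=
    Projectivization.map_injective _ _
  rw [← Set.ncard_univ, ← Set.ncard_image_of_injective _ hinj, ← Set.ncard_coe_finset]
  congr 1
  ext p
  simp only [Finset.mem_coe, mem_projPts, Set.image_univ, Set.mem_range]
  constructor
  · intro h
    induction p using Projectivization.ind with
    | h v hv =>
      rw [Projectivization.submodule_mk, Submodule.span_singleton_le_iff_mem] at h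
      exact ⟨Projectivization.mk F ⟨v, h⟩ (fun h' => hv (congrArg Subtype.val h')), by
        rw [Projectivization.map_mk]; rfl⟩
  · rintro ⟨y, rfl⟩
    induction y using Projectivization.ind with
    | h v hv =>
      rw [Projectivization.map_mk, Projectivization.submodule_mk,
        Submodule.span_singleton_le_iff_mem]
      exact v.2

theorem geom_bound (q k : ℕ) (hq : 2 ≤ q) (hk : 1 ≤ k) :
    ∑ i ∈ Finset.range k, q ^ i ≤ 2 * q ^ (k - 1) := by
  induction k, hk using Nat.le_induction with
  | base => simp
  | succ k hk ih =>
    obtain ⟨j, rfl⟩ := Nat.exists_eq_add_of_le' hk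
    rw [Finset.sum_range_succ]
    simp only [Nat.add_sub_cancel] at *
    have : 2 * q ^ j ≤ q ^ (j + 1) := by rw [pow_succ']; exact Nat.mul_le_mul_right _ hq
    omega

theorem sunflower_of_large {F : Type} [Field F] [Fintype F] {n k c : ℕ} (hk : 1 ≤ k)
    (hc : c < k) (hn : 3 * k ≤ n + 1) (hq : 9 ≤ Fintype.card F)
    {C : Set (Submodule F (Fin n → F))} (hC : IsEquidistantCode F n k c C)
    (hbig : Fintype.card F ^ (n - k) ≤ C.ncard) : IsSunflower C := by
  classical
  have : Fintype (ℙ F (Fin n → F)) := Fintype.ofFinite _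
  set q := Fintype.card F with hqd
  have hqN : Nat.card F = q := Nat.card_eq_fintype_card
  have hCf : C.Finite := Set.toFinite C
  let D : Finset (Finset (ℙ F (Fin n → F))) := hCf.toFinset.image projPts
  have hDc : D.card = C.ncard := by
    rw [Finset.card_image_of_injective _ (fun U W h => projPts_inj h),
      Set.ncard_eq_toFinset_card C hCf]
  let P : ℕ → ℕ := fun j => ∑ i ∈ Finset.range j, q ^ i
  have hPlt : P c < P k := by
    refine Finset.sum_lt_sum_of_subset (i := c) (Finset.range_mono hc.le) (by simpa using hc)
      (by simp) (by positivity) (fun _ _ _ => by positivity)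
  have hPk : P k ≤ 2 * q ^ (k - 1) := geom_bound q k (by omega) hk
  have hbound : 2 * P k * P k + 1 < D.card := by
    rw [hDc]
    refine lt_of_lt_of_le ?_ hbig
    have h1 : q ^ (2 * k - 1) ≤ q ^ (n - k) := Nat.pow_le_pow_right (by omega) (by omega)
    have h2 : q ^ (2 * k - 1) = q * (q ^ (k - 1) * q ^ (k - 1)) := by
      rw [← pow_add, ← pow_succ']; congr 1; omega
    have h3 : P k * P k ≤ (2 * q ^ (k - 1)) * (2 * q ^ (k - 1)) := Nat.mul_le_mul hPk hPk
    have h4 : 1 ≤ P k := by omega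
    have h5 : 1 ≤ q ^ (k - 1) := Nat.one_le_pow _ _ (by omega)
    have h6 : 9 * (q ^ (k - 1) * q ^ (k - 1)) ≤ q * (q ^ (k - 1) * q ^ (k - 1)) :=
      Nat.mul_le_mul_right _ hq
    by_cases h7 : k = 1
    · subst h7
      have : P 1 = 1 := by simp [P]
      rw [this]
      have h8 : q ^ (2 * 1 - 1) = q := by norm_num
      omega
    · have : 9 ≤ q ^ (k - 1) := hq.trans (Nat.le_self_pow (by omega) _)
      nlinarith
  obtain ⟨H, hH⟩ := deza_sets D (P k) (P c) hPlt
    (by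
      intro A hA
      obtain ⟨U, hU, rfl⟩ := Finset.mem_image.1 hA
      rw [card_projPts, hC.2.1 U (hCf.mem_toFinset.1 hU), hqN])
    (by
      intro A hA B hB hAB
      obtain ⟨U, hU, rfl⟩ := Finset.mem_image.1 hA
      obtain ⟨V, hV, rfl⟩ := Finset.mem_image.1 hB
      rw [← projPts_inf, card_projPts, hC.2.2 U (hCf.mem_toFinset.1 hU) V
        (hCf.mem_toFinset.1 hV) (fun h => hAB (by rw [h])), hqN])
    hbound
  have hH' : ∀ U ∈ C, ∀ V ∈ C, U ≠ V → projPts (U ⊓ V) = H := by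
    intro U hU V hV hUV
    rw [projPts_inf]
    exact hH _ (Finset.mem_image_of_mem _ (hCf.mem_toFinset.2 hU)) _
      (Finset.mem_image_of_mem _ (hCf.mem_toFinset.2 hV)) (fun h => hUV (projPts_inj h))
  obtain ⟨U, hU, V, hV, hUV⟩ := (Set.one_lt_ncard hCf).1 hC.1
  exact ⟨U ⊓ V, fun U' hU' V' hV' h =>
    projPts_inj ((hH' U' hU' V' hV' h).trans (hH' U hU V hV hUV).symm)⟩

theorem sunflower_reduce {F : Type} [Field F] [Fintype F] {n k c : ℕ}
    {C : Set (Submodule F (Fin n → F))} (hC : IsEquidistantCode F n k c C)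
    (hS : IsSunflower C) : C.ncard ≤ eMax F (n - c) (k - c) 0 := by
  have hCf : C.Finite := Set.toFinite C
  obtain ⟨Z, hZ⟩ := hS
  have hother : ∀ U ∈ C, ∃ V ∈ C, U ≠ V := by
    intro U hU
    obtain ⟨V, hV, h⟩ := Set.exists_ne_of_one_lt_ncard hC.1 U
    exact ⟨V, hV, h.symm⟩
  have hZle : ∀ U ∈ C, Z ≤ U := by
    intro U hU
    obtain ⟨V, hV, h⟩ := hother U hU
    rw [← hZ U hU V hV h]
    exact inf_le_left
  have hZc : Module.finrank F Z = c := by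
    obtain ⟨U, hU, V, hV, hUV⟩ := (Set.one_lt_ncard hCf).1 hC.1
    rw [← hZ U hU V hV hUV]
    exact hC.2.2 U hU V hV hUV
  let e : ((Fin n → F) ⧸ Z) ≃ₗ[F] (Fin (n - c) → F) := LinearEquiv.ofFinrankEq _ _ (by
    have := Z.finrank_quotient_add_finrank
    simp only [Module.finrank_fin_fun] at *
    omega)
  let f : (Fin n → F) →ₗ[F] (Fin (n - c) → F) := e.toLinearMap ∘ₗ Z.mkQ
  have hf : Function.Surjective f := e.surjective.comp Z.mkQ_surjective
  have hker : LinearMap.ker f = Z := by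
    simp [f, LinearMap.ker_comp]
  have hcm : ∀ U ∈ C, (U.map f).comap f = U := by
    intro U hU
    rw [Submodule.comap_map_eq, hker, sup_eq_left]
    exact hZle U hU
  have hinj : Set.InjOn (fun U : Submodule F (Fin n → F) => U.map f) C := by
    intro U hU V hV h
    simp only at h
    rw [← hcm U hU, ← hcm V hV, h]
  have hcard := hinj.ncard_image
  rw [← hcard]
  refine code_le_eMax ⟨by rw [hcard]; exact hC.1, ?_, ?_⟩
  · rintro _ ⟨U, hU, rfl⟩
    have := finrank_comap_surj f hf (U.map f)
    rw [hcm U hU, hC.2.1 U hU, hker, hZc] at this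
    simp only
    omega
  · rintro _ ⟨U, hU, rfl⟩ _ ⟨V, hV, rfl⟩ hUV
    have hne : U ≠ V := fun h => hUV (by rw [h])
    have := finrank_comap_surj f hf (U.map f ⊓ V.map f)
    rw [Submodule.comap_inf, hcm U hU, hcm V hV, hC.2.2 U hU V hV hne, hker, hZc] at this
    simp only
    omega

end helpers

/-- For `n ≥ 3k - 1` and `q ≫ 0`, `e_q(k,n,c) = e_q(k-c, n-c, 0)` and every optimal
equidistant `c`-intersecting code in `G_q(k,n)` is a sunflower. -/
theorem optimal_code_is_sunflower_of_large_q
    (k n c : ℕ) (hk : 1 ≤ k) (hkn : k < n) (hn : 3 * k ≤ n + 1) (hc : c ≤ k - 1) :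
    ∃ Q : ℕ, ∀ q : ℕ, IsPrimePow q → Q ≤ q →
      ∀ (F : Type) [Field F] [Fintype F], Fintype.card F = q →
        eMax F n k c = eMax F (n - c) (k - c) 0 ∧
        ∀ C : Set (Submodule F (Fin n → F)),
          IsEquidistantCode F n k c C → C.ncard = eMax F n k c → IsSunflower C := by
  refine ⟨9, ?_⟩
  intro q _ hq F _ _ hF
  subst hF
  have hlow : ∃ C : Set (Submodule F (Fin (n - c) → F)),
      IsEquidistantCode F (n - c) (k - c) 0 C ∧ C.ncard = Fintype.card F ^ (n - k) := by
    have h := exists_spread F (k - c) (n - k) (by omega) (by omega)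
    have e : k - c + (n - k) = n - c := by omega
    rwa [e] at h
  obtain ⟨C0, hC0, hC0c⟩ := hlow
  let f : (Fin n → F) →ₗ[F] (Fin (n - c) → F) :=
    LinearMap.funLeft F F (Fin.castLE (Nat.sub_le n c))
  have hf : Function.Surjective f :=
    LinearMap.funLeft_surjective_of_injective F F _ (Fin.castLE_injective _)
  have hker : Module.finrank F (LinearMap.ker f) = c := by
    have h := LinearMap.finrank_range_add_finrank_ker f
    rw [LinearMap.range_eq_top.2 hf, finrank_top] at h
    simp only [Module.finrank_fin_fun] at h
    omega
  have hkc : k - c + c = k := by omega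
  have hge : eMax F (n - c) (k - c) 0 ≤ eMax F n k c := by
    obtain ⟨D, hD, hDc⟩ := eMax_attained hC0
    obtain ⟨h1, h2⟩ := code_comap f hf hker D hD
    rw [hkc] at h1
    rw [← hDc, ← h2]
    exact code_le_eMax h1
  have hbig : Fintype.card F ^ (n - k) ≤ eMax F n k c :=
    hC0c ▸ (code_le_eMax hC0).trans hge
  have hsun : ∀ C : Set (Submodule F (Fin n → F)),
      IsEquidistantCode F n k c C → C.ncard = eMax F n k c → IsSunflower C := by
    intro C hC hCc
    exact sunflower_of_large hk (by omega) hn hq hC (by rw [hCc]; exact hbig)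
  refine ⟨le_antisymm ?_ hge, hsun⟩
  have h1 := (code_comap f hf hker C0 hC0).1
  rw [hkc] at h1
  obtain ⟨D, hD, hDc⟩ := eMax_attained h1
  rw [← hDc]
  exact sunflower_reduce hD (hsun D hD hDc)
end

section
/- Let q be a prime power, 1 ≤ k < n, 0 ≤ c ≤ k−1 with n ≥ 2k − c, and let C ⊆ G_q(k,n) be an equidistant c-intersecting code with |C| = e_q(k,n,c). Then C and C^⊥ are both sunflowers if and only if n = 2k, c = 0, and both C and C^⊥ are spreads, i.e., partial spreads of cardinality q^k + 1. -/
open Submodule Module Set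

lemma stdOrth_eq {F : Type} [Field F] {n : ℕ} (U : Submodule F (Fin n → F)) :
    stdOrth U = U.dualAnnihilator.comap (dotProductEquiv F (Fin n)).toLinearMap := by
  ext x
  simp only [Submodule.mem_comap, Submodule.mem_dualAnnihilator]
  rfl

lemma finrank_stdOrth {F : Type} [Field F] {n : ℕ} (U : Submodule F (Fin n → F)) :
    finrank F U + finrank F (stdOrth U) = n := by
  have h := Subspace.finrank_add_finrank_dualAnnihilator_eq U
  rw [Module.finrank_fin_fun] at h
  have h2 : finrank F (stdOrth U) = finrank F U.dualAnnihilator := by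
    rw [stdOrth_eq]
    exact LinearEquiv.finrank_eq (LinearEquiv.ofSubmodule' (dotProductEquiv F (Fin n)) _)
  omega

lemma stdOrth_stdOrth {F : Type} [Field F] {n : ℕ} (U : Submodule F (Fin n → F)) :
    stdOrth (stdOrth U) = U := by
  symm
  apply Submodule.eq_of_le_of_finrank_eq
  · intro x hx y hy
    have := hy x hx
    simpa [mul_comm] using this
  · have h1 := finrank_stdOrth U
    have h2 := finrank_stdOrth (stdOrth U)
    omega

lemma stdOrth_injective {F : Type} [Field F] {n : ℕ} :
    Function.Injective (stdOrth : Submodule F (Fin n → F) → _) :=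
  Function.LeftInverse.injective stdOrth_stdOrth

lemma stdOrth_sup {F : Type} [Field F] {n : ℕ} (U V : Submodule F (Fin n → F)) :
    stdOrth (U ⊔ V) = stdOrth U ⊓ stdOrth V := by
  apply le_antisymm
  · exact le_inf (fun x hx y hy => hx y (Submodule.mem_sup_left hy))
      (fun x hx y hy => hx y (Submodule.mem_sup_right hy))
  · rintro x ⟨h1, h2⟩ y hy
    obtain ⟨a, ha, b, hb, rfl⟩ := Submodule.mem_sup.1 hy
    have e1 := h1 a ha
    have e2 := h2 b hb
    simp [mul_add, Finset.sum_add_distrib, e1, e2]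

lemma card_le_eMax {F : Type} [Field F] [Fintype F] {n k c : ℕ}
    {C : Set (Submodule F (Fin n → F))} (hC : IsEquidistantCode F n k c C) :
    C.ncard ≤ eMax F n k c := by
  have : Finite (Submodule F (Fin n → F)) :=
    Finite.of_injective (fun U => (U : Set (Fin n → F))) SetLike.coe_injective
  apply le_csSup
  · refine ⟨Nat.card (Submodule F (Fin n → F)), ?_⟩
    rintro m ⟨D, -, rfl⟩
    exact Set.ncard_le_card D
  · exact ⟨C, hC, rfl⟩

/-- The maps whose ranges form the lifted field-multiplication sunflower. -/
noncomputable def phiMap {F K : Type} [Field F] [Field K] [Algebra F K] {c t : ℕ}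
    (i : (Fin t → F) →ₗ[F] K) :
    Option K → ((Fin c → F) × (Fin t → F)) →ₗ[F] ((Fin c → F) × (Fin t → F) × K)
  | none => LinearMap.prodMap LinearMap.id (LinearMap.prod 0 i)
  | some a => LinearMap.prodMap LinearMap.id
      (LinearMap.prod LinearMap.id ((LinearMap.mulLeft F a).comp i))

lemma phiMap_inj {F K : Type} [Field F] [Field K] [Algebra F K] {c t : ℕ}
    (i : (Fin t → F) →ₗ[F] K) (hi : Function.Injective i) (o : Option K) :
    Function.Injective (phiMap (c := c) i o) := by
  rintro ⟨a, x⟩ ⟨b, y⟩ h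
  cases o with
  | none =>
    simp only [phiMap, LinearMap.prodMap_apply, LinearMap.prod_apply, Function.prod, Prod.mk.injEq,
      LinearMap.id_apply] at h ⊢
    exact ⟨h.1, hi h.2.2⟩
  | some z =>
    simp only [phiMap, LinearMap.prodMap_apply, LinearMap.prod_apply, Function.prod, Prod.mk.injEq,
      LinearMap.id_apply] at h ⊢
    exact ⟨h.1, h.2.1⟩

lemma phiMap_inf {F K : Type} [Field F] [Field K] [Algebra F K] {c t : ℕ}
    (i : (Fin t → F) →ₗ[F] K) (hi : Function.Injective i) (o p : Option K) (hop : o ≠ p) :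
    LinearMap.range (phiMap (c := c) i o) ⊓ LinearMap.range (phiMap (c := c) i p) =
      LinearMap.range (LinearMap.inl F (Fin c → F) ((Fin t → F) × K)) := by
  have h0 : ∀ x, i x = 0 → x = 0 := fun x hx => hi (by simpa using hx)
  apply le_antisymm
  · rintro v ⟨⟨⟨a, x⟩, h1⟩, ⟨⟨b, y⟩, h2⟩⟩
    have key : x = 0 := by
      have h := h1.trans h2.symm
      cases o with
      | none =>
        cases p with
        | none => exact absurd rfl hop
        | some w =>
          simp only [phiMap, LinearMap.prodMap_apply, LinearMap.prod_apply, Function.prod,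
            Prod.mk.injEq, LinearMap.id_apply, LinearMap.zero_apply, LinearMap.comp_apply,
            LinearMap.mulLeft_apply] at h
          apply h0
          rw [h.2.2, ← h.2.1]; simp
      | some z =>
        cases p with
        | none =>
          simp only [phiMap, LinearMap.prodMap_apply, LinearMap.prod_apply, Function.prod,
            Prod.mk.injEq, LinearMap.id_apply, LinearMap.zero_apply, LinearMap.comp_apply,
            LinearMap.mulLeft_apply] at h
          exact h.2.1
        | some w =>
          simp only [phiMap, LinearMap.prodMap_apply, LinearMap.prod_apply, Function.prod,
            Prod.mk.injEq, LinearMap.id_apply, LinearMap.zero_apply, LinearMap.comp_apply,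
            LinearMap.mulLeft_apply] at h
          obtain ⟨-, rfl, h3⟩ := h
          by_contra hx
          exact hop (congrArg some (mul_right_cancel₀ (fun h4 => hx (h0 _ h4)) h3))
    subst key
    refine ⟨a, ?_⟩
    rw [← h1]
    cases o <;> simp [phiMap] <;> rfl
  · rintro v ⟨a, rfl⟩
    exact ⟨⟨(a, 0), by cases o <;> simp [phiMap]⟩, ⟨(a, 0), by cases p <;> simp [phiMap]⟩⟩

lemma exists_code (F : Type) [Field F] [Fintype F] (n k c : ℕ) (hck : c < k) (hkn : k < n)
    (hn : 2 * k ≤ n + c) :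
    ∃ C : Set (Submodule F (Fin n → F)), IsEquidistantCode F n k c C ∧
      C.ncard = Fintype.card F ^ (n - k) + 1 := by
  obtain ⟨K, fK, aK, hfin, hrank⟩ : ∃ (K : Type) (_ : Field K) (_ : Algebra F K),
      Module.Finite F K ∧ finrank F K = n - k := by
    obtain ⟨p, hp⟩ := CharP.exists F
    have : Fact p.Prime := ⟨CharP.char_is_prime F p⟩
    have : NeZero (n - k) := ⟨by omega⟩
    exact ⟨FiniteField.Extension F p (n - k), inferInstance, inferInstance, inferInstance,
      FiniteField.finrank_extension F p (n - k)⟩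
  have hcard : Nat.card K = Fintype.card F ^ (n - k) := by
    rw [Module.natCard_eq_pow_finrank (K := F) (V := K), hrank, Nat.card_eq_fintype_card]
  have : Finite K := Module.finite_of_finite F
  obtain ⟨i, hi⟩ : ∃ i : (Fin (k - c) → F) →ₗ[F] K, Function.Injective i := by
    have e0 : (Fin (n - k) → F) ≃ₗ[F] K := LinearEquiv.ofFinrankEq _ _ (by simp [hrank])
    have hle : k - c ≤ n - k := by omega
    exact ⟨e0.toLinearMap.comp (Function.ExtendByZero.linearMap F (Fin.castLE hle)),
      e0.injective.comp (fun x y h => by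
        funext j
        have := congrFun h (Fin.castLE hle j)
        simpa [(Fin.castLE_injective hle).extend_apply] using this)⟩
  have e : ((Fin c → F) × (Fin (k - c) → F) × K) ≃ₗ[F] (Fin n → F) := by
    apply LinearEquiv.ofFinrankEq
    simp [Module.finrank_prod, hrank]; omega
  set f : Option K → Submodule F (Fin n → F) :=
    fun o => (LinearMap.range (phiMap (c := c) i o)).map e.toLinearMap with hf
  have hdim : ∀ o, finrank F (f o) = k := by
    intro o
    rw [hf]
    simp only
    rw [LinearEquiv.finrank_map_eq, LinearMap.finrank_range_of_inj (phiMap_inj i hi o)]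
    simp [Module.finrank_prod]; omega
  have hint : ∀ o p, o ≠ p → finrank F ↥(f o ⊓ f p) = c := by
    intro o p hop
    have : f o ⊓ f p = (LinearMap.range (LinearMap.inl F (Fin c → F) ((Fin (k - c) → F) × K))).map
        e.toLinearMap := by
      rw [← phiMap_inf i hi o p hop, Submodule.map_inf _ e.injective]
    rw [this, LinearEquiv.finrank_map_eq, LinearMap.finrank_range_of_inj LinearMap.inl_injective]
    simp
  have hinj : Function.Injective f := by
    intro o p h
    by_contra hop
    have h1 := hint o p hop
    rw [h, inf_idem, hdim] at h1
    omega
  have hnc : (Set.range f).ncard = Fintype.card F ^ (n - k) + 1 := by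
    rw [← Set.image_univ, Set.ncard_image_of_injective _ hinj, Set.ncard_univ,
      Finite.card_option, hcard]
  refine ⟨Set.range f, ⟨?_, ?_, ?_⟩, hnc⟩
  · rw [hnc]
    have : 0 < Fintype.card F ^ (n - k) := pow_pos Fintype.card_pos _
    omega
  · rintro _ ⟨o, rfl⟩; exact hdim o
  · rintro _ ⟨o, rfl⟩ _ ⟨p, rfl⟩ h
    exact hint o p (fun h' => h (by rw [h']))

lemma dual_code {F : Type} [Field F] [Fintype F] {n k c : ℕ} {C : Set (Submodule F (Fin n → F))}
    (hC : IsEquidistantCode F n k c C) {c' : ℕ} (hc' : n + c = 2 * k + c') :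
    IsEquidistantCode F n (n - k) c' (stdOrth '' C) := by
  obtain ⟨h1, h2, h3⟩ := hC
  refine ⟨?_, ?_, ?_⟩
  · rwa [Set.ncard_image_of_injective _ stdOrth_injective]
  · rintro _ ⟨U, hU, rfl⟩
    have := finrank_stdOrth U
    have := h2 U hU
    omega
  · rintro _ ⟨U, hU, rfl⟩ _ ⟨V, hV, rfl⟩ h
    have hUV : U ≠ V := fun h' => h (by rw [h'])
    rw [← stdOrth_sup]
    have a1 := finrank_stdOrth (U ⊔ V)
    have a2 := Submodule.finrank_sup_add_finrank_inf_eq U V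
    rw [h2 U hU, h2 V hV, h3 U hU V hV hUV] at a2
    omega

lemma upper_bound {F : Type} [Field F] [Fintype F] {n k c : ℕ} (hck : c < k)
    {C : Set (Submodule F (Fin n → F))}
    (hC : IsEquidistantCode F n k c C) (h1 : IsSunflower C) (h2 : IsSunflower (stdOrth '' C)) :
    C.ncard ≤ Fintype.card F ^ (k - c) + 1 := by
  classical
  obtain ⟨hC1, hC2, hC3⟩ := hC
  obtain ⟨Z, hZ⟩ := h1
  obtain ⟨Z', hZ'⟩ := h2
  have : Finite (Submodule F (Fin n → F)) :=
    Finite.of_injective (fun U => (U : Set (Fin n → F))) SetLike.coe_injective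
  have hW : ∀ U ∈ C, ∀ V ∈ C, U ≠ V → U ⊔ V = stdOrth Z' := by
    intro U hU V hV h
    rw [← hZ' _ ⟨U, hU, rfl⟩ _ ⟨V, hV, rfl⟩ (fun h' => h (stdOrth_injective h')),
      ← stdOrth_sup, stdOrth_stdOrth]
  set W := stdOrth Z' with hWdef
  have hcard : ∀ U : Submodule F (Fin n → F), (U : Set (Fin n → F)).ncard =
      Fintype.card F ^ finrank F U := by
    intro U
    rw [← Nat.card_coe_set_eq, ← Nat.card_eq_fintype_card]
    exact Module.natCard_eq_pow_finrank (K := F) (V := U)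
  have hother : ∀ U ∈ C, ∃ V ∈ C, U ≠ V := by
    intro U hU
    obtain ⟨V, hV, hne⟩ := Set.exists_ne_of_one_lt_ncard (by omega : 1 < C.ncard) U
    exact ⟨V, hV, hne.symm⟩
  obtain ⟨U₀, hU₀⟩ : C.Nonempty := Set.nonempty_of_ncard_ne_zero (by omega)
  obtain ⟨V₀, hV₀, hne₀⟩ := hother U₀ hU₀
  have hZc : finrank F Z = c := by rw [← hZ U₀ hU₀ V₀ hV₀ hne₀]; exact hC3 _ hU₀ _ hV₀ hne₀
  have hWc : finrank F W = 2 * k - c := by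
    have a2 := Submodule.finrank_sup_add_finrank_inf_eq U₀ V₀
    rw [hC2 _ hU₀, hC2 _ hV₀, hC3 _ hU₀ _ hV₀ hne₀, hW _ hU₀ _ hV₀ hne₀] at a2
    omega
  have hZU : ∀ U ∈ C, Z ≤ U := by
    intro U hU
    obtain ⟨V, hV, h⟩ := hother U hU
    rw [← hZ U hU V hV h]; exact inf_le_left
  have hUW : ∀ U ∈ C, U ≤ W := by
    intro U hU
    obtain ⟨V, hV, h⟩ := hother U hU
    rw [← hW U hU V hV h]; exact le_sup_left
  have hCf : C.Finite := Set.toFinite C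
  set q := Fintype.card F with hq
  set g : Submodule F (Fin n → F) → Finset (Fin n → F) :=
    fun U => ((U : Set (Fin n → F)) \ Z).toFinset with hg
  have hgc : ∀ U, Z ≤ U → (g U).card = q ^ finrank F U - q ^ c := by
    intro U hU
    rw [hg]
    simp only
    rw [← Set.ncard_eq_toFinset_card', Set.ncard_sdiff hU, hcard, hcard, hZc]
  have hdisj : ((hCf.toFinset : Set _)).PairwiseDisjoint g := by
    intro U hU V hV h
    have hU' : U ∈ C := by simpa using hU
    have hV' : V ∈ C := by simpa using hV
    rw [Function.onFun, Finset.disjoint_left]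
    intro x hx hy
    simp only [hg, Set.mem_toFinset, Set.mem_sdiff, SetLike.mem_coe] at hx hy
    apply hx.2
    rw [← hZ U hU' V hV' h]
    exact ⟨hx.1, hy.1⟩
  have hsum : C.ncard * (q ^ k - q ^ c) ≤ q ^ (2 * k - c) - q ^ c := by
    have e1 : (hCf.toFinset.biUnion g).card = C.ncard * (q ^ k - q ^ c) := by
      rw [Finset.card_biUnion hdisj, Set.ncard_eq_toFinset_card C hCf]
      rw [Finset.sum_const_nat]
      intro U hU
      have hU' : U ∈ C := by simpa using hU
      rw [hgc U (hZU U hU'), hC2 U hU']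
    rw [← e1, ← hWc, ← hgc W ((hZU U₀ hU₀).trans (hUW U₀ hU₀))]
    apply Finset.card_le_card
    intro x hx
    obtain ⟨U, hU, hx⟩ := Finset.mem_biUnion.1 hx
    have hU' : U ∈ C := by simpa using hU
    simp only [hg, Set.mem_toFinset, Set.mem_sdiff, SetLike.mem_coe] at hx ⊢
    exact ⟨hUW U hU' hx.1, hx.2⟩
  have hq1 : 1 < q := Fintype.one_lt_card
  obtain ⟨t, rfl⟩ : ∃ t, k = c + t := ⟨k - c, by omega⟩
  have ht : c + t - c = t := by omega
  have ht2 : 2 * (c + t) - c = c + (t + t) := by omega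
  rw [ht2] at hsum
  rw [ht]
  have hqt : 1 < q ^ t := Nat.one_lt_pow (by omega) hq1
  have hqc : 0 < q ^ c := pow_pos (by omega) _
  obtain ⟨r, hr⟩ : ∃ r, q ^ t = r + 2 := ⟨q ^ t - 2, by omega⟩
  have e1 : q ^ (c + t) - q ^ c = q ^ c * (r + 1) := by
    rw [pow_add, hr, Nat.sub_eq_iff_eq_add (by nlinarith)]; ring
  have e2 : q ^ (c + (t + t)) - q ^ c = (r + 2 + 1) * (q ^ c * (r + 1)) := by
    rw [pow_add, pow_add, hr, Nat.sub_eq_iff_eq_add (by nlinarith)]; ring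
  rw [e1, e2] at hsum
  rw [hr]
  exact Nat.le_of_mul_le_mul_right hsum (by positivity)

/-- For an optimal equidistant `c`-intersecting code `C ⊆ G_q(k,n)`, both `C` and
`C^⊥` are sunflowers if and only if `n = 2k`, `c = 0`, and both `C` and `C^⊥` are
spreads, i.e. partial spreads of cardinality `q^k + 1`. -/
theorem both_sunflowers_iff_spreads
    (q : ℕ) (hq : IsPrimePow q) (F : Type) [Field F] [Fintype F]
    (hF : Fintype.card F = q) (k n c : ℕ) (hk : 1 ≤ k) (hkn : k < n) (hc : c ≤ k - 1)
    (hn : 2 * k ≤ n + c)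
    (C : Set (Submodule F (Fin n → F))) (hC : IsEquidistantCode F n k c C)
    (hmax : C.ncard = eMax F n k c) :
    (IsSunflower C ∧ IsSunflower (stdOrth '' C)) ↔
      (n = 2 * k ∧ c = 0 ∧
       (∀ U ∈ C, ∀ V ∈ C, U ≠ V → U ⊓ V = ⊥) ∧ C.ncard = q ^ k + 1 ∧
       (∀ A ∈ stdOrth '' C, ∀ B ∈ stdOrth '' C, A ≠ B → A ⊓ B = ⊥) ∧
       (stdOrth '' C).ncard = q ^ k + 1) := by
  subst hF
  have hq1 : 1 < Fintype.card F := Fintype.one_lt_card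
  constructor
  · rintro ⟨h1, h2⟩
    have hub := upper_bound (by omega) hC h1 h2
    have hlow1 : Fintype.card F ^ (n - k) + 1 ≤ C.ncard := by
      obtain ⟨D, hD, hDc⟩ := exists_code F n k c (by omega) hkn hn
      rw [hmax, ← hDc]
      exact card_le_eMax hD
    have hle1 : n - k ≤ k - c :=
      (Nat.pow_le_pow_iff_right hq1).1 (by omega)
    have hlow2 : Fintype.card F ^ k + 1 ≤ C.ncard := by
      obtain ⟨D, hD, hDc⟩ := exists_code F n (n - k) 0 (by omega) (by omega) (by omega)
      have hD' := dual_code hD (c' := c) (by omega)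
      have hnk : n - (n - k) = k := by omega
      rw [hnk] at hD' hDc
      rw [hmax, ← hDc, ← Set.ncard_image_of_injective D stdOrth_injective]
      exact card_le_eMax hD'
    have hle2 : k ≤ k - c :=
      (Nat.pow_le_pow_iff_right hq1).1 (by omega)
    have hc0 : c = 0 := by omega
    subst hc0
    have hn2 : n = 2 * k := by omega
    have hcard : C.ncard = Fintype.card F ^ k + 1 := by
      apply le_antisymm _ hlow2
      simpa using hub
    refine ⟨hn2, rfl, ?_, hcard, ?_, ?_⟩
    · intro U hU V hV h
      exact Submodule.finrank_eq_zero.1 (hC.2.2 U hU V hV h)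
    · intro U hU V hV h
      exact Submodule.finrank_eq_zero.1 ((dual_code hC (c' := 0) (by omega)).2.2 U hU V hV h)
    · rw [Set.ncard_image_of_injective _ stdOrth_injective, hcard]
  · rintro ⟨-, -, h1, -, h2, -⟩
    exact ⟨⟨⊥, h1⟩, ⟨⊥, h2⟩⟩
end
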